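/- arXiv:1105.0185 — 5 statements merged into one kernel-verified Lean document; each statement's English description precedes it below -/
import Mathlib

section
/- Let m ≥ 3. Then (i) the Ricci map ρ is surjective from 𝔄 onto the space of all bilinear forms on V, and (ii) 𝔄 ∩ ker(ρ) is an irreducible GL(V)-module: the only subspaces of 𝔄 ∩ ker(ρ) that are invariant under the action of every invertible linear map of V are {0} and 𝔄 ∩ ker(ρ) itself. -/
open Module

variable {V : Type*} [AddCommGroup V] [Module ℝ V]

/-- `A` is an affine curvature operator: antisymmetric in the first two slots and
satisfying the first Bianchi identity. -/
def IsAff (A : V →ₗ[ℝ] V →ₗ[ℝ] V →ₗ[ℝ] V) : Prop :=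
  (∀ x y, A x y = - A y x) ∧ ∀ x y z, A x y z + A y z x + A z x y = 0

/-- The Ricci tensor `ρ(A)(x,y) = Tr (z ↦ A(z,x)y)`. -/
noncomputable def rho (A : V →ₗ[ℝ] V →ₗ[ℝ] V →ₗ[ℝ] V) (x y : V) : ℝ :=
  LinearMap.trace ℝ V ((A.flip x).flip y)


theorem eq_zero_of_self_neg (f : V →ₗ[ℝ] V) (h : f = -f) : f = 0 := by
  have h2 : (2 : ℝ) • f = 0 := by
    rw [two_smul]; exact eq_neg_iff_add_eq_zero.1 h
  exact (smul_eq_zero.1 h2).resolve_left (by norm_num)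

/-- The rank-one type elements. -/
def TT (α β : V →ₗ[ℝ] ℝ) (v : V) : V →ₗ[ℝ] V →ₗ[ℝ] V →ₗ[ℝ] V :=
  LinearMap.mk₂ ℝ (fun x y => (α x * β y - α y * β x) • α.smulRight v)
    (by intros; ext; simp; module) (by intros; ext; simp; module)
    (by intros; ext; simp; module) (by intros; ext; simp; module)

theorem TT_apply (α β : V →ₗ[ℝ] ℝ) (v x y z : V) :
    TT α β v x y z = ((α x * β y - α y * β x) * α z) • v := by
  simp [TT, mul_smul]

/-- The group action. -/
def act (g : V ≃ₗ[ℝ] V) (A : V →ₗ[ℝ] V →ₗ[ℝ] V →ₗ[ℝ] V) : V →ₗ[ℝ] V →ₗ[ℝ] V →ₗ[ℝ] V :=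
  (A.compl₁₂ (g.symm : V →ₗ[ℝ] V) (g.symm : V →ₗ[ℝ] V)).compr₂ (LinearEquiv.conj g : _ →ₗ[ℝ] _)

theorem act_apply (g : V ≃ₗ[ℝ] V) (A : V →ₗ[ℝ] V →ₗ[ℝ] V →ₗ[ℝ] V) (x y z : V) :
    act g A x y z = g (A (g.symm x) (g.symm y) (g.symm z)) := by
  simp [act, LinearEquiv.conj_apply]

theorem part_one [FiniteDimensional ℝ V] (hm : 3 ≤ finrank ℝ V) (φ : V →ₗ[ℝ] V →ₗ[ℝ] ℝ) :
    ∃ A : V →ₗ[ℝ] V →ₗ[ℝ] V →ₗ[ℝ] V, IsAff A ∧ ∀ x y, rho A x y = φ x y := by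
  obtain ⟨m, hmd⟩ : ∃ m : ℝ, m = (finrank ℝ V : ℝ) := ⟨_, rfl⟩
  have hm3 : (3 : ℝ) ≤ m := by rw [hmd]; exact_mod_cast hm
  have hm1 : m ^ 2 - 1 ≠ 0 := by nlinarith
  obtain ⟨ψ, hψ⟩ : ∃ ψ : V →ₗ[ℝ] V →ₗ[ℝ] ℝ, ψ = (m ^ 2 - 1)⁻¹ • (m • φ + φ.flip) := ⟨_, rfl⟩
  let A : V →ₗ[ℝ] V →ₗ[ℝ] V →ₗ[ℝ] V :=
    LinearMap.mk₂ ℝ (fun x y => (ψ y).smulRight x - (ψ x).smulRight y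
        + (ψ y x - ψ x y) • (LinearMap.id : V →ₗ[ℝ] V))
    (by intros; ext; simp; module) (by intros; ext; simp; module)
    (by intros; ext; simp; module) (by intros; ext; simp; module)
  have hA : ∀ x y z, A x y z = ψ y z • x - ψ x z • y + (ψ y x - ψ x y) • z := by
    intro x y z; simp [A]
  refine ⟨A, ⟨?_, ?_⟩, ?_⟩
  · intro x y; ext z; simp only [hA, LinearMap.neg_apply]; module
  · intro x y z; simp only [hA]; module
  · intro x y
    have : (A.flip x).flip y = (ψ x y) • (LinearMap.id : V →ₗ[ℝ] V) - (ψ.flip y).smulRight x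
        + (ψ x - ψ.flip x).smulRight y := by
      ext z; simp [hA]
    rw [rho, this]
    simp only [map_add, map_sub, map_smul, LinearMap.trace_smulRight, LinearMap.trace_id, ← hmd]
    simp [hψ]
    field_simp
    ring

theorem L1 [FiniteDimensional ℝ V] (f : V →ₗ[ℝ] V) (v : V) (hv : v ≠ 0)
    (h : ∀ (α : V →ₗ[ℝ] ℝ) (y : V), α v = 0 → α y = 0 → α (f y) = 0) :
    ∃ (c : ℝ) (ω : V →ₗ[ℝ] ℝ), ∀ y, f y = c • y + ω y • v := by
  have hs : ∀ y, ∃ a b : ℝ, a • v + b • y = f y := by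
    intro y
    have : f y ∈ Submodule.span ℝ {v, y} := by
      by_contra hn
      obtain ⟨α, hα, hle⟩ := Submodule.exists_le_ker_of_notMem hn
      apply hα
      apply h α y
      · exact hle (Submodule.subset_span (by simp))
      · exact hle (Submodule.subset_span (by simp))
    exact Submodule.mem_span_pair.1 this
  let S := Submodule.span ℝ {v}
  have hS : S ≤ S.comap f := by
    rw [Submodule.span_singleton_le_iff_mem, Submodule.mem_comap, Submodule.mem_span_singleton]
    obtain ⟨a, b, hab⟩ := hs v
    exact ⟨a + b, by rw [← hab]; module⟩
  have hvS : S.mkQ v = 0 := by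
    simp only [Submodule.mkQ_apply, Submodule.Quotient.mk_eq_zero]
    exact Submodule.mem_span_singleton_self v
  obtain ⟨c, hc⟩ : ∃ c : ℝ, S.mapQ S f hS = c • 1 := by
    apply LinearMap.exists_eq_smul_id_of_forall_notLinearIndependent
    intro q hq
    obtain ⟨y, rfl⟩ := S.mkQ_surjective q
    obtain ⟨a, b, hab⟩ := hs y
    rw [LinearIndependent.pair_iff] at hq
    have := hq b (-1) (by
      have : S.mapQ S f hS (S.mkQ y) = S.mkQ (f y) := rfl
      rw [this, ← hab, map_add, map_smul, map_smul, hvS]; module)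
    norm_num at this
  have hc' : ∀ y, ∃ a : ℝ, a • v = f y - c • y := by
    intro y
    have h1 := LinearMap.congr_fun hc (S.mkQ y)
    have h2 : S.mkQ (f y - c • y) = 0 := by
      rw [map_sub, map_smul, sub_eq_zero]; exact h1
    rw [Submodule.mkQ_apply, Submodule.Quotient.mk_eq_zero] at h2
    exact Submodule.mem_span_singleton.1 h2
  obtain ⟨α, hα⟩ : ∃ α : V →ₗ[ℝ] ℝ, α v = 1 :=
    Module.Projective.exists_dual_eq_one ℝ hv
  refine ⟨c, α ∘ₗ (f - c • LinearMap.id), fun y => ?_⟩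
  obtain ⟨a, ha⟩ := hc' y
  have : (α ∘ₗ (f - c • LinearMap.id)) y = a := by
    have : (α ∘ₗ (f - c • LinearMap.id)) y = α (f y - c • y) := by simp
    rw [this, ← ha]; simp [hα]
  rw [this, ha]; module

/-- Third difference trick. -/
theorem step_one (ξ : Submodule ℝ (V →ₗ[ℝ] V →ₗ[ℝ] V →ₗ[ℝ] V))
    (hξ : ∀ (g : V ≃ₗ[ℝ] V), ∀ A ∈ ξ, act g A ∈ ξ)
    (A : V →ₗ[ℝ] V →ₗ[ℝ] V →ₗ[ℝ] V) (hA : A ∈ ξ) (hA2 : ∀ x y, A x y = - A y x)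
    (α : V →ₗ[ℝ] ℝ) (v : V) (hv : α v = 0) :
    TT α (α ∘ₗ (A v).flip v) v ∈ ξ := by
  have ht : ∀ t : ℝ, α (t • v) = 0 := by intro t; simp [hv]
  let g : ℝ → V ≃ₗ[ℝ] V := fun t => LinearEquiv.transvection (ht t)
  have hg : ∀ t w, g t w = w + (t * α w) • v := by
    intro t w
    simp [g, LinearEquiv.transvection, LinearMap.transvection, smul_smul, mul_comm]
  have hgs : ∀ t w, (g t).symm w = w - (t * α w) • v := by
    intro t w
    rw [LinearEquiv.symm_apply_eq, hg]; simp [hv]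
  have hvv : A v v = 0 := by
    exact eq_zero_of_self_neg _ (hA2 v v)
  have key : TT α (α ∘ₗ (A v).flip v) v = (1/12 : ℝ) • (act (g 2) A + (-2:ℝ) • act (g 1) A
      + (2:ℝ) • act (g (-1)) A + (-1 : ℝ) • act (g (-2)) A) := by
    ext x y z
    have hxv : A x v = - A v x := hA2 x v
    simp only [LinearMap.smul_apply, LinearMap.sub_apply, LinearMap.add_apply, act_apply, hg, hgs,
      TT_apply, map_sub, map_smul, hvv, hxv, LinearMap.comp_apply, LinearMap.flip_apply,
      LinearMap.neg_apply, map_neg, smul_eq_mul, LinearMap.zero_apply, map_zero]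
    module
  rw [key]
  exact ξ.smul_mem _ (ξ.add_mem (ξ.add_mem (ξ.add_mem (hξ _ _ hA) (ξ.smul_mem _ (hξ _ _ hA)))
    (ξ.smul_mem _ (hξ _ _ hA))) (ξ.smul_mem _ (hξ _ _ hA)))

theorem vanish [FiniteDimensional ℝ V] (hm : 3 ≤ finrank ℝ V)
    (A : V →ₗ[ℝ] V →ₗ[ℝ] V →ₗ[ℝ] V) (hA : IsAff A) (hr : ∀ x y, rho A x y = 0)
    (H : ∀ (α : V →ₗ[ℝ] ℝ) (v y : V), α v = 0 → α y = 0 → α (A v y v) = 0) : A = 0 := by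
  obtain ⟨m, hmd⟩ : ∃ m : ℝ, m = (finrank ℝ V : ℝ) := ⟨_, rfl⟩
  have hm3 : (3 : ℝ) ≤ m := by rw [hmd]; exact_mod_cast hm
  obtain ⟨hA1, hA2⟩ := hA
  have hvv : ∀ v, A v v = 0 := fun v => eq_zero_of_self_neg _ (hA1 v v)
  -- first: `A v y v` is a multiple of `v`
  have P1 : ∀ v, v ≠ 0 → ∃ ω : V →ₗ[ℝ] ℝ, ∀ y, A v y v = ω y • v := by
    intro v hv
    obtain ⟨c, ω, h⟩ := L1 ((A v).flip v) v hv (fun α y h1 h2 => H α v y h1 h2)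
    have h' : (A v).flip v = c • LinearMap.id + ω.smulRight v := by
      ext y; rw [h]; simp
    have h0 : c + ω v = 0 := by
      have := h v
      rw [LinearMap.flip_apply, hvv, LinearMap.zero_apply, ← add_smul] at this
      exact (smul_eq_zero.1 this.symm).resolve_right hv
    have htr : LinearMap.trace ℝ V ((A v).flip v) = 0 := by
      have := hr v v
      have e : (A v).flip v = - (A.flip v).flip v := by
        ext y; simp [hA1 v y]
      rw [e, map_neg]; simpa [rho] using this
    rw [h'] at htr
    simp only [map_add, map_smul, LinearMap.trace_smulRight, LinearMap.trace_id, ← hmd,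
      smul_eq_mul] at htr
    have hc : c = 0 := by
      have : c * (m - 1) = 0 := by linarith
      rcases mul_eq_zero.1 this with h | h
      · exact h
      · linarith
    refine ⟨ω, fun y => ?_⟩
    have := h y
    rw [hc] at this; simpa using this
  have P1' : ∀ v y, ∃ a : ℝ, A v y v = a • v := by
    intro v y
    by_cases hv : v = 0
    · exact ⟨0, by simp [hv]⟩
    · obtain ⟨ω, h⟩ := P1 v hv; exact ⟨_, h y⟩
  have htrA : ∀ v y, LinearMap.trace ℝ V (A v y) = 0 := by
    intro v y
    have e : A v y = (A.flip y).flip v - (A.flip v).flip y := by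
      ext w
      have h := hA2 v y w
      have h2 := LinearMap.congr_fun (hA1 y w) v
      simp only [LinearMap.sub_apply, LinearMap.flip_apply, LinearMap.neg_apply] at *
      rw [h2] at h
      linear_combination (norm := module) h
    rw [e, map_sub]
    have h1 := hr y v
    have h2 := hr v y
    simp only [rho] at h1 h2
    rw [h1, h2, sub_zero]
  have P2 : ∀ v y, A v y v = 0 := by
    intro v y
    by_cases hv : v = 0
    · simp [hv]
    let f : V →ₗ[ℝ] V := (A.flip y).flip v + A v y
    have hf : ∀ w, f w = A w y v + A v y w := by intro w; simp [f]
    obtain ⟨c, ω, h⟩ := L1 f v hv (by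
      intro α w h1 h2
      obtain ⟨a, ha⟩ := P1' v y
      obtain ⟨b, hb⟩ := P1' w y
      obtain ⟨d, hd⟩ := P1' (v + w) y
      have : f w = d • (v + w) - a • v - b • w := by
        rw [hf, ← ha, ← hb, ← hd]; simp only [map_add, LinearMap.add_apply]; abel
      rw [this]; simp [h1, h2])
    have h' : f = c • LinearMap.id + ω.smulRight v := by
      ext y; rw [h]; simp
    have htr : LinearMap.trace ℝ V f = 0 := by
      have := hr y v
      simp only [rho] at this
      simp only [f, map_add, htrA, this, add_zero]
    rw [h'] at htr
    simp only [map_add, map_smul, LinearMap.trace_smulRight, LinearMap.trace_id, ← hmd,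
      smul_eq_mul] at htr
    obtain ⟨w, hw⟩ : ∃ w, LinearIndependent ℝ ![v, w] := by
      exact exists_linearIndependent_pair_of_one_lt_finrank (by omega) hv
    rw [LinearIndependent.pair_iff] at hw
    have hcω : c = ω v := by
      obtain ⟨b, hb⟩ := P1' w y
      obtain ⟨d, hd⟩ := P1' (v + w) y
      obtain ⟨d', hd'⟩ := P1' (v - w) y
      have hv2 := h v
      have hw2 := h w
      rw [hf] at hv2 hw2
      simp only [map_add, map_sub, LinearMap.add_apply, LinearMap.sub_apply] at hd hd'
      have e1 := hw ((c + ω v)/2 + ω w - d) (b + c - d) (by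
        linear_combination (norm := module) (-1/2 : ℝ) • hv2 - hw2 - hb + hd)
      have e2 := hw ((c + ω v)/2 - ω w - d') (b - c + d') (by
        linear_combination (norm := module) (-1/2 : ℝ) • hv2 + hw2 - hb + hd')
      linarith [e1.1, e1.2, e2.1, e2.2]
    have hc : c = 0 := by
      have : c * (m + 1) = 0 := by linear_combination htr + hcω
      rcases mul_eq_zero.1 this with h | h
      · exact h
      · linarith
    have hv2 := h v
    rw [hf, ← hcω, hc] at hv2
    have : (2 : ℝ) • A v y v = 0 := by rw [two_smul, hv2]; simp
    exact (smul_eq_zero.1 this).resolve_left (by norm_num)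
  ext x y z
  have h1 : A x y z + A z y x = 0 := by
    have := P2 (x + z) y
    simp only [map_add, LinearMap.add_apply, P2, zero_add, add_zero] at this
    rw [add_comm]; exact this
  have h2 : A y x z + A z x y = 0 := by
    have := P2 (y + z) x
    simp only [map_add, LinearMap.add_apply, P2, zero_add, add_zero] at this
    rw [add_comm]; exact this
  have h3 := LinearMap.congr_fun (hA1 x y) z
  have h4 := LinearMap.congr_fun (hA1 y z) x
  have h5 := hA2 x y z
  simp only [LinearMap.neg_apply] at h3 h4
  have : (3 : ℝ) • A x y z = 0 := by
    rw [h4] at h5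
    have e1 : A z y x = - A x y z := by rw [eq_neg_iff_add_eq_zero, add_comm]; exact h1
    have e2 : A z x y = A x y z := by rw [h3]; rw [eq_neg_iff_add_eq_zero, add_comm]; exact h2
    rw [e1, e2] at h5
    rw [← h5]; module
  simpa using this

theorem exists_g {W : Type*} [AddCommGroup W] [Module ℝ W] [FiniteDimensional ℝ V]
    (L0 L : V →ₗ[ℝ] W) (s0 s : W →ₗ[ℝ] V) (h0 : ∀ w, L0 (s0 w) = w) (h : ∀ w, L (s w) = w) :
    ∃ g : V ≃ₗ[ℝ] V, (∀ x, L (g x) = L0 x) ∧ ∀ w, g (s0 w) = s w := by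
  have hs0 : LinearMap.range L0 = ⊤ := LinearMap.range_eq_top.2 fun w => ⟨_, h0 w⟩
  have hs : LinearMap.range L = ⊤ := LinearMap.range_eq_top.2 fun w => ⟨_, h w⟩
  have hd : finrank ℝ (LinearMap.ker L0) = finrank ℝ (LinearMap.ker L) := by
    have a := LinearMap.finrank_range_add_finrank_ker L0
    have b := LinearMap.finrank_range_add_finrank_ker L
    rw [hs0] at a; rw [hs] at b; omega
  let e := LinearEquiv.ofFinrankEq _ _ hd
  let p : V →ₗ[ℝ] LinearMap.ker L0 := LinearMap.codRestrict _ (LinearMap.id - s0 ∘ₗ L0) (by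
    intro c; simp [h0])
  let f : V →ₗ[ℝ] V := (LinearMap.ker L).subtype ∘ₗ e.toLinearMap ∘ₗ p + s ∘ₗ L0
  have hL : ∀ x, L (f x) = L0 x := by
    intro x
    have : L (e (p x) : V) = 0 := (e (p x)).2
    simp [f, h, this]
  have hinj : Function.Injective f := by
    rw [← LinearMap.ker_eq_bot, LinearMap.ker_eq_bot']
    intro x hx
    have h1 : L0 x = 0 := by rw [← hL, hx, map_zero]
    have h2 : f x = (e (p x) : V) := by simp [f, h1]
    have h3 : e (p x) = 0 := by ext; rw [← h2, hx]; rfl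
    have h4 : p x = 0 := by simpa using h3
    have h5 : ((p x : LinearMap.ker L0) : V) = x := by simp [p, h1]
    rw [← h5, h4]; rfl
  refine ⟨LinearEquiv.ofInjectiveEndo f hinj, fun x => by simp [hL], fun w => ?_⟩
  have : p (s0 w) = 0 := by ext; simp [p, h0]
  simp [f, this, h0]

theorem exists_sec [FiniteDimensional ℝ V] (α β : V →ₗ[ℝ] ℝ) (v : V) (hv : v ≠ 0)
    (hα : α v = 0) (hβ : β v = 0) (x y : V) (hD : α x * β y - α y * β x ≠ 0) :
    ∃ (γ : V →ₗ[ℝ] ℝ) (s : ℝ × ℝ × ℝ →ₗ[ℝ] V), (∀ w, (α.prod (β.prod γ)) (s w) = w) ∧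
      s (0, 0, 1) = v := by
  obtain ⟨γ, hγ⟩ : ∃ α : V →ₗ[ℝ] ℝ, α v = 1 := Module.Projective.exists_dual_eq_one ℝ hv
  obtain ⟨D, hDD⟩ : ∃ D, D = α x * β y - α y * β x := ⟨_, rfl⟩
  rw [← hDD] at hD
  let a : V := D⁻¹ • (β y • x - β x • y)
  let b : V := D⁻¹ • (α x • y - α y • x)
  have h1 : α a = 1 := by simp [a]; field_simp; rw [hDD]; try ring
  have h2 : β a = 0 := by simp [a]; right; ring
  have h3 : α b = 0 := by simp [b]; right; ring
  have h4 : β b = 1 := by simp [b]; field_simp; rw [hDD]; try ring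
  refine ⟨γ - γ a • α - γ b • β,
    (LinearMap.toSpanSingleton ℝ V a).coprod ((LinearMap.toSpanSingleton ℝ V b).coprod
      (LinearMap.toSpanSingleton ℝ V v)), ?_, ?_⟩
  · rintro ⟨p, q, r⟩
    simp [h1, h2, h3, h4, hα, hβ, hγ]
    ring
  · simp

theorem TT_trans [FiniteDimensional ℝ V] (ξ : Submodule ℝ (V →ₗ[ℝ] V →ₗ[ℝ] V →ₗ[ℝ] V))
    (hξ : ∀ (g : V ≃ₗ[ℝ] V), ∀ A ∈ ξ, act g A ∈ ξ)
    (α₀ β₀ : V →ₗ[ℝ] ℝ) (v₀ : V) (hv₀ : v₀ ≠ 0)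
    (hα₀ : α₀ v₀ = 0) (hβ₀ : β₀ v₀ = 0) (x₀ y₀ : V) (hD₀ : α₀ x₀ * β₀ y₀ - α₀ y₀ * β₀ x₀ ≠ 0)
    (hT : TT α₀ β₀ v₀ ∈ ξ)
    (α β : V →ₗ[ℝ] ℝ) (v : V) (hα : α v = 0) (hβ : β v = 0) : TT α β v ∈ ξ := by
  by_cases hv : v = 0
  · have : TT α β v = 0 := by ext; simp [TT_apply, hv]
    rw [this]; exact ξ.zero_mem
  by_cases hD : ∃ x y, α x * β y - α y * β x ≠ 0
  swap
  · push Not at hD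
    have : TT α β v = 0 := by ext; simp [TT_apply, hD]
    rw [this]; exact ξ.zero_mem
  obtain ⟨x, y, hD⟩ := hD
  obtain ⟨γ₀, s₀, h₀, hs₀⟩ := exists_sec α₀ β₀ v₀ hv₀ hα₀ hβ₀ x₀ y₀ hD₀
  obtain ⟨γ, s, h, hs⟩ := exists_sec α β v hv hα hβ x y hD
  obtain ⟨g, hg1, hg2⟩ := exists_g _ _ s₀ s h₀ h
  have hgv : g v₀ = v := by rw [← hs₀, hg2, hs]
  have h1 : ∀ z, α₀ (g.symm z) = α z := by
    intro z
    have := hg1 (g.symm z)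
    simp only [LinearEquiv.apply_symm_apply] at this
    exact (congrArg Prod.fst this).symm
  have h2 : ∀ z, β₀ (g.symm z) = β z := by
    intro z
    have := hg1 (g.symm z)
    simp only [LinearEquiv.apply_symm_apply] at this
    exact (congrArg (fun p => p.2.1) this).symm
  have : TT α β v = act g (TT α₀ β₀ v₀) := by
    ext a b c
    simp [act_apply, TT_apply, h1, h2, hgv]
  rw [this]; exact hξ _ _ hT

theorem TT_mem (α β : V →ₗ[ℝ] ℝ) (v : V) [FiniteDimensional ℝ V] (hα : α v = 0) (hβ : β v = 0) :
    IsAff (TT α β v) ∧ ∀ x y, rho (TT α β v) x y = 0 := by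
  refine ⟨⟨?_, ?_⟩, ?_⟩
  · intro x y; ext z; simp only [TT_apply, LinearMap.neg_apply]; module
  · intro x y z; simp only [TT_apply]; module
  · intro x y
    have : ((TT α β v).flip x).flip y = (α y • (β x • α - α x • β)).smulRight v := by
      ext z; simp [TT_apply]; congr 1; ring
    rw [rho, this, LinearMap.trace_smulRight]; simp [hα, hβ]

/-- Coordinates. -/
noncomputable def coords {ι : Type*} [Fintype ι] (b : Basis ι ℝ V) :
    (V →ₗ[ℝ] V →ₗ[ℝ] V →ₗ[ℝ] V) →ₗ[ℝ] EuclideanSpace ℝ (ι × ι × ι × ι) where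
  toFun A := WithLp.toLp 2 fun p => b.repr (A (b p.1) (b p.2.1) (b p.2.2.1)) p.2.2.2
  map_add' A B := by ext; simp
  map_smul' r A := by ext; simp

theorem coords_inner [FiniteDimensional ℝ V] {ι : Type*} [Fintype ι] (b : Basis ι ℝ V)
    (A : V →ₗ[ℝ] V →ₗ[ℝ] V →ₗ[ℝ] V) (hA : ∀ x y, A x y = - A y x) (a c w : ι → ℝ) :
    inner ℝ (coords b (TT (b.constr ℝ a) (b.constr ℝ c) (∑ i, w i • b i))) (coords b A) =
      2 * (b.constr ℝ w) (A (∑ i, a i • b i) (∑ i, c i • b i) (∑ i, a i • b i)) := by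
  classical
  have e1 : inner ℝ (coords b (TT (b.constr ℝ a) (b.constr ℝ c) (∑ i, w i • b i))) (coords b A)
      = ∑ i, ∑ j, ∑ k, ∑ l, ((a i * c j - a j * c i) * a k * w l) *
        b.repr (A (b i) (b j) (b k)) l := by
    rw [PiLp.inner_apply]
    simp only [Fintype.sum_prod_type]
    refine Finset.sum_congr rfl fun i _ => Finset.sum_congr rfl fun j _ =>
      Finset.sum_congr rfl fun k _ => Finset.sum_congr rfl fun l _ => ?_
    have : b.repr (∑ i, w i • b i) l = w l := by
      rw [Basis.repr_sum_self]
    simp only [coords, LinearMap.coe_mk, AddHom.coe_mk, TT_apply, Basis.constr_basis, map_smul,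
      Finsupp.smul_apply, this, smul_eq_mul, RCLike.inner_apply, conj_trivial]
    ring
  have e2 : ∀ x y z, (b.constr ℝ w) (A x y z) = ∑ l, w l * b.repr (A x y z) l := by
    intro x y z
    rw [Basis.constr_apply_fintype]; simp [Basis.equivFun_apply, mul_comm]
  have e3 : ∀ p q : ι → ℝ, (b.constr ℝ w)
      (A (∑ i, p i • b i) (∑ i, q i • b i) (∑ i, a i • b i)) =
      ∑ i, ∑ j, ∑ k, ∑ l, (p i * q j * a k * w l) * b.repr (A (b i) (b j) (b k)) l := by
    intro p q
    simp only [map_sum, map_smul, LinearMap.sum_apply, LinearMap.smul_apply, e2, smul_eq_mul,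
      Finset.mul_sum]
    refine (Finset.sum_congr rfl fun k _ => Finset.sum_comm).trans ?_
    rw [Finset.sum_comm]
    refine (Finset.sum_congr rfl fun k _ => Finset.sum_comm).trans ?_
    refine Finset.sum_congr rfl fun i _ => Finset.sum_congr rfl fun j _ =>
      Finset.sum_congr rfl fun k _ => Finset.sum_congr rfl fun l _ => ?_
    ring
  have e4 := e3 a c
  have e5 := e3 c a
  rw [hA, LinearMap.neg_apply, map_neg, e4] at e5
  rw [e1, e4]
  have e6 : ∑ i, ∑ j, ∑ k, ∑ l, ((a i * c j - a j * c i) * a k * w l) *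
        b.repr (A (b i) (b j) (b k)) l = 
      ∑ i, ∑ j, ∑ k, ∑ l, (a i * c j * a k * w l) * b.repr (A (b i) (b j) (b k)) l -
      ∑ i, ∑ j, ∑ k, ∑ l, (c i * a j * a k * w l) * b.repr (A (b i) (b j) (b k)) l := by
    simp only [← Finset.sum_sub_distrib]
    refine Finset.sum_congr rfl fun i _ => Finset.sum_congr rfl fun j _ =>
      Finset.sum_congr rfl fun k _ => Finset.sum_congr rfl fun l _ => ?_
    ring
  rw [e6, ← e5]; ring

theorem decompose [FiniteDimensional ℝ V] (hm : 3 ≤ finrank ℝ V)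
    (A : V →ₗ[ℝ] V →ₗ[ℝ] V →ₗ[ℝ] V) (hA : IsAff A) (hr : ∀ x y, rho A x y = 0)
    (ξ : Submodule ℝ (V →ₗ[ℝ] V →ₗ[ℝ] V →ₗ[ℝ] V))
    (h1 : ∀ B ∈ ξ, IsAff B ∧ ∀ x y, rho B x y = 0)
    (h2 : ∀ (α β : V →ₗ[ℝ] ℝ) (v : V), α v = 0 → β v = 0 → TT α β v ∈ ξ) : A ∈ ξ := by
  let b := Module.finBasis ℝ V
  obtain ⟨y, ⟨B, hB, rfl⟩, z, hz, hyz⟩ :=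
    (ξ.map (coords b)).exists_add_mem_mem_orthogonal (coords b A)
  have hz' : z = coords b (A - B) := by
    have e : A - B = A + (-1 : ℝ) • B := by module
    rw [e, map_add, map_smul, hyz]; module
  obtain ⟨⟨hB1, hB2⟩, hB3⟩ := h1 B hB
  have hC1 : ∀ x y, (A - B) x y = - (A - B) y x := by
    intro x y
    simp only [LinearMap.sub_apply]; rw [hA.1 x y, hB1 x y]; abel
  have hAB : A - B = 0 := by
    apply vanish hm
    · refine ⟨hC1, ?_⟩
      intro x y z
      have := hA.2 x y z
      have h' := hB2 x y z
      simp only [LinearMap.sub_apply]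
      linear_combination (norm := module) this - h'
    · intro x y
      have e : ((A - B).flip x).flip y = (A.flip x).flip y - (B.flip x).flip y := by ext; simp
      have p := hr x y
      have q := hB3 x y
      simp only [rho] at *
      rw [e, map_sub, p, q, sub_zero]
    · intro α v y hv hy
      let a : Fin _ → ℝ := fun i => b.repr v i
      let c : Fin _ → ℝ := fun i => b.repr y i
      let w : Fin _ → ℝ := fun i => α (b i)
      have ev : ∑ i, a i • b i = v := b.sum_repr v
      have ey : ∑ i, c i • b i = y := b.sum_repr y
      have ew : b.constr ℝ w = α := by apply b.ext; intro i; simp [w]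
      have key := coords_inner b (A - B) hC1 a c w
      rw [ev, ey, ew] at key
      have hsw : ∀ a : Fin _ → ℝ, b.constr ℝ a (∑ i, w i • b i) = α (∑ i, a i • b i) := by
        intro a
        simp [map_sum, w, mul_comm]
      have hmem := h2 (b.constr ℝ a) (b.constr ℝ c) (∑ i, w i • b i)
        (by rw [hsw, ev, hv]) (by rw [hsw, ey, hy])
      have hin := (Submodule.mem_orthogonal _ _).1 hz _ (Submodule.mem_map_of_mem hmem)
      rw [hz', key] at hin
      linarith
  have e : A = B := sub_eq_zero.1 hAB
  rw [e]; exact hB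

/-- if `m ≥ 3`, then (i) `ρ` maps `𝔄` onto the space of all bilinear
forms, and (ii) `𝔄 ∩ ker ρ` is an irreducible `GL(V)`-module. -/
theorem statement0 [FiniteDimensional ℝ V] (hm : 3 ≤ finrank ℝ V) :
    (∀ φ : V →ₗ[ℝ] V →ₗ[ℝ] ℝ,
      ∃ A : V →ₗ[ℝ] V →ₗ[ℝ] V →ₗ[ℝ] V, IsAff A ∧ ∀ x y, rho A x y = φ x y) ∧
    (∀ ξ : Submodule ℝ (V →ₗ[ℝ] V →ₗ[ℝ] V →ₗ[ℝ] V),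
      (∀ A ∈ ξ, IsAff A ∧ ∀ x y, rho A x y = 0) →
      (∀ g : V ≃ₗ[ℝ] V, ∀ A ∈ ξ, ∀ B : V →ₗ[ℝ] V →ₗ[ℝ] V →ₗ[ℝ] V,
        (∀ x y z, B x y z = g (A (g.symm x) (g.symm y) (g.symm z))) → B ∈ ξ) →
      ξ = ⊥ ∨ ∀ A : V →ₗ[ℝ] V →ₗ[ℝ] V →ₗ[ℝ] V,
        IsAff A → (∀ x y, rho A x y = 0) → A ∈ ξ) := by
  refine ⟨part_one hm, fun ξ h1 hinv => ?_⟩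
  have hact : ∀ (g : V ≃ₗ[ℝ] V), ∀ A ∈ ξ, act g A ∈ ξ :=
    fun g A hA => hinv g A hA _ (act_apply g A)
  by_cases hb : ξ = ⊥
  · exact Or.inl hb
  right
  obtain ⟨A, hA, hA0⟩ := Submodule.exists_mem_ne_zero_of_ne_bot hb
  have hn : ¬ ∀ (α : V →ₗ[ℝ] ℝ) (v y : V), α v = 0 → α y = 0 → α (A v y v) = 0 :=
    fun H => hA0 (vanish hm A (h1 A hA).1 (h1 A hA).2 H)
  push Not at hn
  obtain ⟨α, v, y, hv, hy, hne⟩ := hn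
  have hT := step_one ξ hact A hA (h1 A hA).1.1 α v hv
  have hvv : A v v = 0 := eq_zero_of_self_neg _ ((h1 A hA).1.1 v v)
  have hv0 : v ≠ 0 := by rintro rfl; simp at hne
  obtain ⟨x, hx⟩ : ∃ x, α x ≠ 0 := ⟨_, hne⟩
  intro B hB hB2
  refine decompose hm B hB hB2 ξ h1 fun α' β' v' ha hb => ?_
  refine TT_trans ξ hact α _ v hv0 hv ?_ x y ?_ hT α' β' v' ha hb
  · simp [hvv]
  · simp [hy, hx, hne]
end

section
/- If m ≥ 6, then K₋ ∩ ker(ρ) is a nonzero irreducible GL_ℂ* module: K₋ ∩ ker(ρ) ≠ {0} and its only GL_ℂ*-invariant subspaces are {0} and K₋ ∩ ker(ρ) itself. -/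
open Module

variable {V : Type*} [AddCommGroup V] [Module ℝ V]

/-- `A` is an affine Kähler curvature operator: `A ∈ 𝔄` and `A(x,y)` commutes with `J`. -/
def IsK (J : V →ₗ[ℝ] V) (A : V →ₗ[ℝ] V →ₗ[ℝ] V →ₗ[ℝ] V) : Prop :=
  IsAff A ∧ ∀ x y z, A x y (J z) = J (A x y z)

/-- `A ∈ K₋`. -/
def IsKminus (J : V →ₗ[ℝ] V) (A : V →ₗ[ℝ] V →ₗ[ℝ] V →ₗ[ℝ] V) : Prop :=
  IsK J A ∧ ∀ x y, A (J x) (J y) = - A x y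

/-- `g ∈ GL_ℂ*`: `g` commutes or anticommutes with `J`. -/
def IsGLstar (J : V →ₗ[ℝ] V) (g : V ≃ₗ[ℝ] V) : Prop :=
  (∀ v, g (J v) = J (g v)) ∨ (∀ v, g (J v) = - J (g v))

set_option linter.unusedSectionVars false
set_option linter.unusedSimpArgs false

namespace KW
section gen

lemma gdim {K M : Type*} [Field K] [AddCommMonoid M] [Module K M] [Module.Finite K M]
    (ξ W : Submodule K M) (h : ξ ≤ W) (P : M →ₗ[K] M →ₗ[K] K)
    (hP : ∀ A ∈ W, (∀ B ∈ ξ, P A B = 0) → A = 0) : ξ = W := by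
  letI : AddCommGroup M := Module.addCommMonoidToAddCommGroup K
  let L : W →ₗ[K] Dual K ξ := (LinearMap.lcomp K K ξ.subtype) ∘ₗ P ∘ₗ W.subtype
  have hL : Function.Injective L := by
    rw [injective_iff_map_eq_zero]
    rintro ⟨A, hA⟩ hz
    ext
    refine hP A hA fun B hB => ?_
    exact congrArg (fun f : Dual K ξ => f ⟨B, hB⟩) hz
  have := LinearMap.finrank_le_finrank_of_injective hL
  rw [Subspace.dual_finrank_eq] at this
  exact Submodule.eq_of_le_of_finrank_le h this

lemma gscal {K M : Type*} [Field K] [AddCommMonoid M] [Module K M] (f : M →ₗ[K] M)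
    (h : ∀ v, ∃ s t : K, t ≠ 0 ∧ s • v + t • f v = 0) : ∃ b : K, ∀ v, f v = b • v := by
  letI : AddCommGroup M := Module.addCommMonoidToAddCommGroup K
  have hnot : ∀ v, ¬ LinearIndependent K ![v, f v] := by
    intro v hli
    rw [LinearIndependent.pair_iff] at hli
    obtain ⟨s, t, ht, hst⟩ := h v
    exact ht (hli s t hst).2
  obtain ⟨b, hb⟩ := LinearMap.exists_eq_smul_id_of_forall_notLinearIndependent hnot
  exact ⟨b, fun v => by rw [hb]; simp⟩

variable {K : Type*} [Field K] [CharZero K] {V : Type*} [AddCommGroup V] [Module K V]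

/-- trilinear maps -/
abbrev Tri (K V : Type*) [Field K] [AddCommGroup V] [Module K V] := V →ₗ[K] V →ₗ[K] V →ₗ[K] V

noncomputable def TT (α β : Dual K V) (e : V) : Tri K V :=
  LinearMap.mk₂ K (fun x y => (α x * β y - α y * β x) • α.smulRight e)
    (by intros; ext; simp only [map_add, LinearMap.smul_apply, LinearMap.add_apply,
          LinearMap.smulRight_apply]; module)
    (by intros; ext; simp only [map_smul, smul_eq_mul, LinearMap.smul_apply,
          LinearMap.smulRight_apply]; module)
    (by intros; ext; simp only [map_add, LinearMap.smul_apply, LinearMap.add_apply,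
          LinearMap.smulRight_apply]; module)
    (by intros; ext; simp only [map_smul, smul_eq_mul, LinearMap.smul_apply,
          LinearMap.smulRight_apply]; module)

lemma TT_apply (α β : Dual K V) (e x y z : V) :
    TT α β e x y z = ((α x * β y - α y * β x) * α z) • e := by
  simp [TT, mul_smul]

/-- complex Weyl tensors -/
def Wsub (K V : Type*) [Field K] [AddCommGroup V] [Module K V] : Submodule K (Tri K V) where
  carrier := {A | (∀ x y z, A x y z = - A y x z) ∧
    (∀ x y z, A x y z + A y z x + A z x y = 0) ∧
    (∀ x y, LinearMap.trace K V ((A.flip x).flip y) = 0)}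
  zero_mem' := by
    refine ⟨by simp, by simp, fun x y => ?_⟩
    have : ((0 : Tri K V).flip x).flip y = 0 := by ext; simp
    rw [this, map_zero]
  add_mem' := by
    rintro A B ⟨h1, h2, h3⟩ ⟨k1, k2, k3⟩
    refine ⟨fun x y z => ?_, fun x y z => ?_, fun x y => ?_⟩
    · simp only [LinearMap.add_apply]; rw [h1 x y z, k1 x y z]; abel
    · simp only [LinearMap.add_apply]
      have := congrArg₂ (· + ·) (h2 x y z) (k2 x y z)
      simp only [add_zero] at this
      rw [← this]; abel
    · have : ((A + B).flip x).flip y = (A.flip x).flip y + (B.flip x).flip y := by ext; simp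
      rw [this, map_add, h3, k3, add_zero]
  smul_mem' := by
    rintro c A ⟨h1, h2, h3⟩
    refine ⟨fun x y z => ?_, fun x y z => ?_, fun x y => ?_⟩
    · simp only [LinearMap.smul_apply]; rw [h1 x y z, smul_neg]
    · simp only [LinearMap.smul_apply]; rw [← smul_add, ← smul_add, h2, smul_zero]
    · have : ((c • A).flip x).flip y = c • (A.flip x).flip y := by ext; simp
      rw [this, map_smul, h3, smul_zero]

lemma mem_Wsub (A : Tri K V) : A ∈ Wsub K V ↔ (∀ x y z, A x y z = - A y x z) ∧
    (∀ x y z, A x y z + A y z x + A z x y = 0) ∧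
    (∀ x y, LinearMap.trace K V ((A.flip x).flip y) = 0) := Iff.rfl

lemma self_zero {A : Tri K V} (hA : A ∈ Wsub K V) (x z : V) : A x x z = 0 := by
  have h := hA.1 x x z
  have : (2 : K) • A x x z = 0 := by rw [two_smul]; nth_rewrite 1 [h]; simp
  simpa using this

/-- the transvection `1 + α ⊗ e` -/
noncomputable def tv (α : Dual K V) (e : V) (h : α e = 0) : V ≃ₗ[K] V :=
  LinearEquiv.ofLinearMap (LinearMap.id + α.smulRight e) (LinearMap.id - α.smulRight e)
    (by ext x; simp [h]) (by ext x; simp [h])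

lemma tv_apply (α : Dual K V) (e : V) (h : α e = 0) (x : V) : tv α e h x = x + α x • e := by
  simp [tv]
lemma tv_symm (α : Dual K V) (e : V) (h : α e = 0) (x : V) :
    (tv α e h).symm x = x - α x • e := by
  simp [tv]

/-- the action -/
noncomputable def act (g : V ≃ₗ[K] V) (A : Tri K V) : Tri K V :=
  LinearMap.mk₂ K (fun x y => g.toLinearMap ∘ₗ (A (g.symm x) (g.symm y)) ∘ₗ g.symm.toLinearMap)
    (by intros; ext; simp) (by intros; ext; simp) (by intros; ext; simp) (by intros; ext; simp)

lemma act_apply (g : V ≃ₗ[K] V) (A : Tri K V) (x y z : V) :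
    act g A x y z = g (A (g.symm x) (g.symm y) (g.symm z)) := by
  simp [act]

/-- extraction of the leading coefficient -/
lemma extract {A : Tri K V} (hA : A ∈ Wsub K V) (ξ : Submodule K (Tri K V))
    (hξ : ∀ g : V ≃ₗ[K] V, act g A ∈ ξ) (α : Dual K V) (e : V) (h : α e = 0) :
    TT α (α ∘ₗ (A e).flip e) e ∈ ξ := by
  have h0 := self_zero hA
  have ht : ∀ t : K, α (t • e) = 0 := by intro t; simp [h]
  have key : (12 : K) • TT α (α ∘ₗ (A e).flip e) e =
      act (tv α ((2:K) • e) (ht 2)) A + (-1 : K) • act (tv α ((-2:K) • e) (ht _)) A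
      + (-2 : K) • act (tv α ((1:K) • e) (ht 1)) A
      + (2 : K) • act (tv α ((-1:K) • e) (ht _)) A := by
    ext x y z
    simp only [LinearMap.add_apply, LinearMap.smul_apply, act_apply, tv_apply, tv_symm, TT_apply,
      LinearMap.comp_apply, LinearMap.flip_apply, LinearMap.sub_apply,
      map_sub, map_smul, map_add, h0, h, hA.1 x e,
      map_neg, smul_eq_mul, smul_zero, map_zero]
    module
  have : (12 : K) • TT α (α ∘ₗ (A e).flip e) e ∈ ξ := by
    rw [key]
    exact ξ.add_mem (ξ.add_mem (ξ.add_mem (hξ _) (ξ.smul_mem _ (hξ _))) (ξ.smul_mem _ (hξ _)))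
      (ξ.smul_mem _ (hξ _))
  exact (ξ.smul_mem_iff (by norm_num)).1 this

lemma exists_dual_one (e : V) (he : e ≠ 0) : ∃ γ : Dual K V, γ e = 1 := by
  obtain ⟨γ, hγ⟩ : ∃ γ : Dual K V, γ e ≠ 0 := by
    by_contra hc; push Not at hc
    exact he ((Module.forall_dual_apply_eq_zero_iff K e).1 hc)
  exact ⟨(γ e)⁻¹ • γ, by simp [hγ]⟩

lemma phi [FiniteDimensional K V] (φ : V →ₗ[K] V) (e : V) (he : e ≠ 0)
    (h : ∀ (α : Dual K V) (y : V), α e = 0 → α y = 0 → α (φ y) = 0) :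
    ∃ (b : K) (l : Dual K V), ∀ y, φ y = b • y + l y • e := by
  let U : Submodule K (Dual K V) := (Submodule.span K {e}).dualAnnihilator
  have hU : ∀ α : Dual K V, α ∈ U ↔ α e = 0 := by
    intro α
    simp only [U, Submodule.mem_dualAnnihilator]
    constructor
    · intro h; exact h e (Submodule.mem_span_singleton_self e)
    · intro h w hw
      obtain ⟨c, rfl⟩ := Submodule.mem_span_singleton.1 hw
      simp [h]
  let ψ : U →ₗ[K] U := φ.dualMap.restrict (by
    intro α hα
    rw [hU] at hα ⊢
    exact h α e hα hα)
  obtain ⟨b, hb⟩ := gscal ψ (by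
    rintro ⟨α, hα⟩
    have hα' := (hU α).1 hα
    by_cases h0 : α = 0
    · subst h0
      refine ⟨0, 1, one_ne_zero, ?_⟩
      ext; simp [ψ]
    obtain ⟨v, hv⟩ : ∃ v, α v ≠ 0 := by
      by_contra hc; push Not at hc; exact h0 (by ext x; simp [hc])
    refine ⟨α (φ v), - α v, neg_ne_zero.2 hv, ?_⟩
    ext x
    have h1 := h α (α x • v - α v • x) hα' (by simp; ring)
    simp only [map_sub, map_smul, smul_eq_mul] at h1
    simp [ψ]
    linear_combination h1)
  obtain ⟨γ, hγ⟩ : ∃ γ : Dual K V, γ e = 1 := by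
    exact exists_dual_one e he
  refine ⟨b, γ ∘ₗ (φ - b • LinearMap.id), fun y => ?_⟩
  have hm : φ y - b • y ∈ Submodule.span K {e} := by
    rw [← Subspace.forall_mem_dualAnnihilator_apply_eq_zero_iff]
    intro α hα
    have := congrArg (fun f : U => (f : Dual K V) y) (hb ⟨α, hα⟩)
    simp [ψ] at this
    simp [this]
  obtain ⟨c, hc⟩ := Submodule.mem_span_singleton.1 hm
  have : γ (φ y - b • y) = c := by rw [← hc]; simp [hγ]
  simp only [LinearMap.comp_apply, LinearMap.sub_apply, LinearMap.smul_apply, LinearMap.id_apply]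
  rw [this, hc]; abel

lemma indep_cancel {e f : V} (hnd : ∀ t : K, f ≠ t • e) (he : e ≠ 0) {a b : K}
    (h : a • e + b • f = 0) : a = 0 ∧ b = 0 := by
  have hb : b = 0 := by
    by_contra hb
    apply hnd (-(b⁻¹ * a))
    have : b⁻¹ • (a • e + b • f) = 0 := by rw [h, smul_zero]
    rw [smul_add, smul_smul, smul_smul, inv_mul_cancel₀ hb, one_smul] at this
    rw [neg_smul]
    exact eq_neg_of_add_eq_zero_right this
  subst hb
  simpa [he] using h

lemma vanish [FiniteDimensional K V] (hn : 3 ≤ finrank K V) {A : Tri K V} (hA : A ∈ Wsub K V)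
    (h : ∀ (α : Dual K V) (e y : V), α e = 0 → α y = 0 → α (A e y e) = 0) : A = 0 := by
  have h0 := self_zero hA
  obtain ⟨hs, hB, hR⟩ := hA
  have st1 : ∀ e : V, ∃ l : Dual K V, (∀ y, A e y e = l y • e) ∧ (e = 0 → l = 0) := by
    intro e
    by_cases he : e = 0
    · exact ⟨0, by simp [he], by simp⟩
    obtain ⟨b, l, hl⟩ := phi ((A e).flip e) e he (fun α y h1 h2 => h α e y h1 h2)
    simp only [LinearMap.flip_apply] at hl
    refine ⟨l, ?_, fun h => absurd h he⟩
    have h1 : b + l e = 0 := by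
      have := hl e
      rw [h0, ← add_smul] at this
      simpa [he] using this.symm
    have h2 : b * finrank K V + l e = 0 := by
      have e1 : (A.flip e).flip e = -(b • LinearMap.id + l.smulRight e) := by
        ext y
        simp only [LinearMap.flip_apply, LinearMap.neg_apply, LinearMap.add_apply,
          LinearMap.smul_apply, LinearMap.id_apply, LinearMap.smulRight_apply]
        rw [hs, hl]
      have := hR e e
      rw [e1, map_neg, map_add, map_smul, LinearMap.trace_id, LinearMap.trace_smulRight] at this
      simp only [smul_eq_mul] at this
      linear_combination -this
    have hb : b * ((finrank K V : K) - 1) = 0 := by linear_combination h2 - h1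
    have hne : (finrank K V : K) - 1 ≠ 0 := by
      rw [sub_ne_zero]
      exact_mod_cast (by omega : finrank K V ≠ 1)
    have hb0 : b = 0 := by simpa [hne] using hb
    intro y
    rw [hl, hb0, zero_smul, zero_add]
  choose l hl hl0 using st1
  have homog : ∀ (t : K) (e y : V), l (t • e) y = t * l e y := by
    intro t e y
    by_cases he : t • e = 0
    · rw [hl0 _ he]
      rcases smul_eq_zero.1 he with h | h
      · simp [h]
      · simp [hl0 _ h]
    have h1 := hl (t • e) y
    simp only [map_smul, LinearMap.smul_apply, hl] at h1
    have ht : t ≠ 0 := fun h => he (by simp [h])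
    have he' : e ≠ 0 := fun h => he (by simp [h])
    have : (t * l (t • e) y - t * (t * l e y)) • e = 0 := by
      rw [sub_smul, sub_eq_zero]
      simp only [mul_smul]
      rw [h1, smul_comm]
    have := (smul_eq_zero.1 this).resolve_right he'
    rw [← mul_sub] at this
    exact sub_eq_zero.1 ((mul_eq_zero.1 this).resolve_left ht)
  have sumr : ∀ e f y : V, A e y f + A f y e = l f y • e + l e y • f := by
    intro e f y
    by_cases he : e = 0
    · subst he; simp [hl0 0 rfl]
    by_cases hnd : ∃ t : K, f = t • e
    · obtain ⟨t, rfl⟩ := hnd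
      simp only [map_smul, LinearMap.smul_apply, hl, homog]
      module
    push Not at hnd
    have h1 := hl (e + f) y
    have h2 := hl (e + (-1 : K) • f) y
    simp only [map_smul, map_add, LinearMap.smul_apply, LinearMap.add_apply, hl] at h1 h2
    set μ := l (e + f) y
    set μ' := l (e + (-1 : K) • f) y
    have h3 : (l e y + l e y - μ - μ') • e + (l f y + l f y - μ + μ') • f = 0 := by
      linear_combination (norm := module) h1 + h2
    obtain ⟨h4, h5⟩ := indep_cancel hnd he h3
    have h6 : μ = l e y + l f y := by linear_combination (-1/2 : K) * h4 - (1/2 : K) * h5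
    rw [h6] at h1
    linear_combination (norm := module) h1
  have diag : ∀ e, l e e = 0 := by
    intro e
    by_cases he : e = 0
    · simp [he]
    have := hl e e
    rw [h0] at this
    simpa [he] using this.symm
  have anti : ∀ e f, l e f = - l f e := by
    intro e f
    by_cases hf : f = 0
    · simp [hf, hl0 0 rfl]
    have h1 := sumr e f f
    rw [hs e f f, hl, h0, diag] at h1
    have : (l e f + l f e) • f = 0 := by
      linear_combination (norm := module) -h1
    exact eq_neg_of_add_eq_zero_left ((smul_eq_zero.1 this).resolve_right hf)
  have form : ∀ e y f, (3 : K) • A e y f = (2 * l e y) • f + l f y • e - l f e • y := by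
    intro e y f
    have h1 := sumr e f y
    have h2 := sumr y f e
    have h3 := hB f y e
    have h4 := hs y e f
    have h5 := hs f e y
    rw [anti y e] at h2
    linear_combination (norm := module) h1 - h2 - h3 + (2:K) • h4 + h5
  have lz : ∀ f y, l f y = 0 := by
    intro f y
    have e1 : (3 : K) • (A.flip y).flip f = (-(2:K)) • (l y).smulRight f + l f y • LinearMap.id
        - (l f).smulRight y := by
      ext e
      simp only [LinearMap.flip_apply, LinearMap.sub_apply, LinearMap.add_apply,
          LinearMap.smul_apply, LinearMap.id_apply, LinearMap.smulRight_apply]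
      rw [form, anti e y]
      module
    have := congrArg (LinearMap.trace K V) e1
    rw [map_smul, hR, map_sub, map_add, map_smul, map_smul, LinearMap.trace_id,
      LinearMap.trace_smulRight, LinearMap.trace_smulRight, anti y f] at this
    simp only [smul_eq_mul] at this
    have h2 : l f y * ((finrank K V : K) + 1) = 0 := by linear_combination -this
    exact (mul_eq_zero.1 h2).resolve_right (Nat.cast_add_one_ne_zero _)
  ext e y f
  have := form e y f
  simp only [lz, mul_zero, zero_smul, add_zero, sub_zero] at this
  simpa using this

lemma trans1 {U : Type*} [AddCommGroup U] [Module K U] [FiniteDimensional K U] (u w : U)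
    (hu : u ≠ 0) (hw : w ≠ 0) : ∃ g : U ≃ₗ[K] U, g u = w := by
  obtain ⟨g, hg⟩ := Submodule.exists_linearEquiv_restrict_eq
    ((LinearEquiv.toSpanNonzeroSingleton K U u hu).symm ≪≫ₗ
      (LinearEquiv.toSpanNonzeroSingleton K U w hw))
  refine ⟨g, ?_⟩
  have := hg ((LinearEquiv.toSpanNonzeroSingleton K U u hu) 1)
  rw [LinearEquiv.trans_apply, LinearEquiv.symm_apply_apply] at this
  simpa using this.symm

lemma surj_pair (α β : Dual K V) (y : V) (hy : α y = 0) (hy' : β y ≠ 0) (hα : α ≠ 0) :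
    Function.Surjective (α.prod β) := by
  obtain ⟨v, hv⟩ : ∃ v, α v ≠ 0 := by
    by_contra hc; push Not at hc; exact hα (by ext x; simp [hc])
  rintro ⟨a, b⟩
  refine ⟨(a * (α v)⁻¹) • v + ((b - a * (α v)⁻¹ * β v) * (β y)⁻¹) • y, ?_⟩
  simp [hy]
  constructor <;> field_simp
  ring

lemma trans [FiniteDimensional K V] (F F' : V →ₗ[K] K × K) (hF : Function.Surjective F)
    (hF' : Function.Surjective F') (e e' : V) (he : F e = 0) (he' : F' e' = 0)
    (h0 : e ≠ 0) (h0' : e' ≠ 0) : ∃ g : V ≃ₗ[K] V, (∀ x, F' (g x) = F x) ∧ g e = e' := by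
  have hd : finrank K (LinearMap.ker F) = finrank K (LinearMap.ker F') := by
    have h1 := F.finrank_range_add_finrank_ker
    have h2 := F'.finrank_range_add_finrank_ker
    rw [LinearMap.range_eq_top.2 hF] at h1
    rw [LinearMap.range_eq_top.2 hF'] at h2
    omega
  let ψ1 := LinearEquiv.ofFinrankEq _ _ hd
  obtain ⟨ψ2, hψ2⟩ := trans1 (K := K) (ψ1 ⟨e, he⟩) ⟨e', he'⟩
    (by intro h; rw [LinearEquiv.map_eq_zero_iff] at h; exact h0 (congrArg Subtype.val h))
    (by intro h; exact h0' (congrArg Subtype.val h))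
  obtain ⟨s, hs⟩ := F.exists_rightInverse_of_surjective (LinearMap.range_eq_top.2 hF)
  obtain ⟨s', hs'⟩ := F'.exists_rightInverse_of_surjective (LinearMap.range_eq_top.2 hF')
  have hs1 : ∀ p, F (s p) = p := fun p => LinearMap.congr_fun hs p
  have hs1' : ∀ p, F' (s' p) = p := fun p => LinearMap.congr_fun hs' p
  let pr : V →ₗ[K] LinearMap.ker F := (LinearMap.id - s ∘ₗ F).codRestrict _ (by
    intro x; simp [hs1])
  let G : V →ₗ[K] V := (LinearMap.ker F').subtype ∘ₗ ψ2.toLinearMap ∘ₗ ψ1.toLinearMap ∘ₗ pr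
    + s' ∘ₗ F
  have hG : ∀ x, G x = (ψ2 (ψ1 (pr x)) : V) + s' (F x) := fun x => by simp [G]
  have hpr : ∀ x (hx : F x = 0), pr x = ⟨x, hx⟩ := by
    intro x hx; ext; simp [pr, hx]
  have hFG : ∀ x, F' (G x) = F x := by
    intro x
    rw [hG, map_add, hs1', LinearMap.mem_ker.1 (ψ2 (ψ1 (pr x))).2, zero_add]
  have hinj : Function.Injective G := by
    rw [injective_iff_map_eq_zero]
    intro x hx
    have h1 : F x = 0 := by rw [← hFG, hx, map_zero]
    rw [hG, h1, map_zero, add_zero, hpr x h1] at hx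
    have h2 : ψ2 (ψ1 ⟨x, h1⟩) = 0 := Subtype.ext hx
    rw [LinearEquiv.map_eq_zero_iff, LinearEquiv.map_eq_zero_iff] at h2
    exact congrArg Subtype.val h2
  refine ⟨LinearEquiv.ofInjectiveEndo G hinj, fun x => ?_, ?_⟩
  · simpa using hFG x
  · simp only [LinearEquiv.coe_ofInjectiveEndo]
    rw [hG, hpr e he, hψ2, he]; simp

lemma act_TT (g : V ≃ₗ[K] V) (α β α' β' : Dual K V) (e : V) (h : ∀ x, α' (g x) = α x)
    (h' : ∀ x, β' (g x) = β x) : act g (TT α β e) = TT α' β' (g e) := by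
  ext x y z
  simp only [act_apply, TT_apply, map_smul, ← h, ← h', LinearEquiv.apply_symm_apply]

lemma TT_zero (α β : Dual K V) (e : V) (h : ∀ y, α y = 0 → β y = 0) : TT α β e = 0 := by
  ext x y z
  have := h (α x • y - α y • x) (by simp; ring)
  simp only [map_sub, map_smul, smul_eq_mul] at this
  simp [TT_apply, this]

lemma all_T [FiniteDimensional K V] (hn : 3 ≤ finrank K V) (ξ : Submodule K (Tri K V))
    (hW : ξ ≤ Wsub K V) (hξ : ∀ g : V ≃ₗ[K] V, ∀ A ∈ ξ, act g A ∈ ξ) (hne : ξ ≠ ⊥)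
    (α β : Dual K V) (e : V) (hα : α e = 0) (hβ : β e = 0) : TT α β e ∈ ξ := by
  obtain ⟨A, hA, hA0⟩ := (Submodule.ne_bot_iff ξ).1 hne
  have hex : ∃ (α : Dual K V) (e y : V), α e = 0 ∧ α y = 0 ∧ α (A e y e) ≠ 0 := by
    by_contra hc
    push Not at hc
    exact hA0 (vanish hn (hW hA) hc)
  obtain ⟨α₀, e₀, y₀, h1, h2, h3⟩ := hex
  have hT := extract (hW hA) ξ (fun g => hξ g A hA) α₀ e₀ h1
  by_cases he : e = 0
  · have : TT α β e = 0 := by ext x y z; simp [TT_apply, he]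
    rw [this]; exact ξ.zero_mem
  by_cases hd : ∀ y, α y = 0 → β y = 0
  · rw [TT_zero α β e hd]; exact ξ.zero_mem
  push Not at hd
  obtain ⟨y, hy1, hy2⟩ := hd
  by_cases ha : α = 0
  · have : TT α β e = 0 := by ext x y z; simp [TT_apply, ha]
    rw [this]; exact ξ.zero_mem
  obtain ⟨g, hg, hge⟩ := trans (α₀.prod (α₀ ∘ₗ (A e₀).flip e₀)) (α.prod β)
    (surj_pair α₀ (α₀ ∘ₗ (A e₀).flip e₀) y₀ h2 h3 (by rintro rfl; simp at h3))
    (surj_pair α β y hy1 hy2 ha) e₀ e (by simp [h1, self_zero (hW hA)]) (by simp [hα, hβ])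
    (by rintro rfl; simp at h3) he
  have := hξ g _ hT
  rw [act_TT g _ _ α β e₀ (fun x => congrArg Prod.fst (hg x))
    (fun x => congrArg Prod.snd (hg x)), hge] at this
  exact this

noncomputable def PP {ι : Type*} [Fintype ι] (b : Basis ι K V) : Tri K V →ₗ[K] Tri K V →ₗ[K] K :=
  LinearMap.mk₂ K (fun A B => ∑ i, ∑ j, ∑ k, ∑ m,
      b.coord m (A (b i) (b j) (b k)) * b.coord m (B (b i) (b j) (b k)))
    (by intros; simp only [LinearMap.add_apply, map_add, add_mul, Finset.sum_add_distrib])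
    (by intros; simp only [LinearMap.smul_apply, map_smul, smul_eq_mul, mul_assoc,
          Finset.mul_sum])
    (by intros; simp only [LinearMap.add_apply, map_add, mul_add, Finset.sum_add_distrib])
    (by intros; simp only [LinearMap.smul_apply, map_smul, smul_eq_mul, mul_left_comm,
          Finset.mul_sum])

lemma exp1 {ι : Type*} [Fintype ι] (b : Basis ι K V) (θ : Dual K V) (x : V) :
    θ x = ∑ m, b.coord m x * θ (b m) := by
  conv_lhs => rw [← b.sum_repr x]
  rw [map_sum]
  simp only [map_smul, smul_eq_mul, Basis.coord_apply]

lemma expand {ι : Type*} [Fintype ι] (b : Basis ι K V) (A : Tri K V) (θ : Dual K V) (u v w : V) :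
    θ (A u v w) = ∑ i, ∑ j, ∑ k, ∑ m,
      b.coord m (A (b i) (b j) (b k)) *
        (b.coord i u * b.coord j v * b.coord k w * θ (b m)) := by
  have e1 : θ (A u v w) = ∑ i, b.coord i u * θ (A (b i) v w) := by
    have := exp1 b (θ ∘ₗ (A.flip v).flip w) u
    simpa using this
  rw [e1]
  refine Finset.sum_congr rfl fun i _ => ?_
  have e2 : θ (A (b i) v w) = ∑ j, b.coord j v * θ (A (b i) (b j) w) := by
    have := exp1 b (θ ∘ₗ (A (b i)).flip w) v
    simpa using this
  rw [e2, Finset.mul_sum]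
  refine Finset.sum_congr rfl fun j _ => ?_
  have e3 : θ (A (b i) (b j) w) = ∑ k, b.coord k w * θ (A (b i) (b j) (b k)) := by
    have := exp1 b (θ ∘ₗ (A (b i) (b j))) w
    simpa using this
  rw [e3, Finset.mul_sum, Finset.mul_sum]
  refine Finset.sum_congr rfl fun k _ => ?_
  rw [exp1 b θ (A (b i) (b j) (b k)), Finset.mul_sum, Finset.mul_sum, Finset.mul_sum]
  refine Finset.sum_congr rfl fun m _ => ?_
  ring

lemma span_T [FiniteDimensional K V] (hn : 3 ≤ finrank K V) (ξ : Submodule K (Tri K V))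
    (hW : ξ ≤ Wsub K V)
    (hT : ∀ (α β : Dual K V) (e : V), α e = 0 → β e = 0 → TT α β e ∈ ξ) : ξ = Wsub K V := by
  classical
  let b := finBasis K V
  refine gdim ξ (Wsub K V) hW (PP b) fun A hA hP => ?_
  refine vanish hn hA fun θ e y he hy => ?_
  let sh : V → Dual K V := fun u => ∑ i, b.coord i u • b.coord i
  have hsh : ∀ u i, sh u (b i) = b.coord i u := by
    intro u i
    simp [sh, LinearMap.sum_apply, Finsupp.single_apply]
  have hsh2 : ∀ u, sh u (∑ m, θ (b m) • b m) = θ u := by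
    intro u
    simp only [map_sum, map_smul, hsh, smul_eq_mul]
    rw [exp1 b θ u]
    simp only [mul_comm]
  have h1 := hP _ (hT (sh e) (sh y) (∑ m, θ (b m) • b m) (by rw [hsh2, he]) (by rw [hsh2, hy]))
  have hc : ∀ m, b.coord m (∑ m, θ (b m) • b m) = θ (b m) := by
    intro m
    simp [Finsupp.single_apply]
  simp only [PP, LinearMap.mk₂_apply, TT_apply, map_smul, hc, hsh, smul_eq_mul] at h1
  have h2 : θ (A e y e) - θ (A y e e) = 0 := by
    rw [expand b A θ e y e, expand b A θ y e e, ← h1]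
    simp only [← Finset.sum_sub_distrib]
    refine Finset.sum_congr rfl fun i _ => Finset.sum_congr rfl fun j _ =>
      Finset.sum_congr rfl fun k _ => Finset.sum_congr rfl fun m _ => ?_
    ring
  rw [hA.1 y e e, map_neg] at h2
  have : (2 : K) * θ (A e y e) = 0 := by linear_combination h2
  simpa using this

lemma mainK [FiniteDimensional K V] (hn : 3 ≤ finrank K V) (ξ : Submodule K (Tri K V))
    (hW : ξ ≤ Wsub K V) (hξ : ∀ g : V ≃ₗ[K] V, ∀ A ∈ ξ, act g A ∈ ξ) (hne : ξ ≠ ⊥) :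
    ξ = Wsub K V :=
  span_T hn ξ hW (all_T hn ξ hW hξ hne)

lemma existsK [FiniteDimensional K V] (hn : 3 ≤ finrank K V) : ∃ A ∈ Wsub K V, A ≠ 0 := by
  let b := finBasis K V
  let i0 : Fin (finrank K V) := ⟨0, by omega⟩
  let i1 : Fin (finrank K V) := ⟨1, by omega⟩
  let i2 : Fin (finrank K V) := ⟨2, by omega⟩
  have h01 : i0 ≠ i1 := by simp [i0, i1]
  have h02 : i0 ≠ i2 := by simp [i0, i2]
  have h12 : i1 ≠ i2 := by simp [i1, i2]
  refine ⟨TT (b.coord i0) (b.coord i1) (b i2), ⟨?_, ?_, ?_⟩, ?_⟩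
  · intro x y z; simp only [TT_apply]; module
  · intro x y z; simp only [TT_apply]; module
  · intro x y
    have : ((TT (b.coord i0) (b.coord i1) (b i2)).flip x).flip y =
      ((b.coord i0 y) • ((b.coord i1 x) • b.coord i0 - (b.coord i0 x) • b.coord i1)).smulRight
        (b i2) := by
      ext z
      simp only [LinearMap.flip_apply, TT_apply, LinearMap.smulRight_apply, LinearMap.smul_apply,
        LinearMap.sub_apply, smul_eq_mul]
      congr 1; ring
    rw [this, LinearMap.trace_smulRight]
    simp [h02, h12]
  · intro h
    have := congrArg (fun A : Tri K V => b.coord i2 (A (b i0) (b i1) (b i0))) h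
    simp [TT_apply, h01] at this

end gen
end KW

namespace KW
section trf
variable {V : Type*} [AddCommGroup V] [Module ℝ V] [Module ℂ V] [IsScalarTower ℝ ℂ V]

lemma csmul (c : ℂ) (v : V) : c • v = c.re • v + c.im • (Complex.I • v) := by
  rw [← smul_assoc, ← one_smul ℂ (c.re • v), smul_comm (1 : ℂ) c.re v, ← smul_assoc, ← add_smul]
  congr 1
  apply Complex.ext <;> simp

noncomputable def res (A : Tri ℂ V) : V →ₗ[ℝ] V →ₗ[ℝ] V →ₗ[ℝ] V :=
  LinearMap.mk₂ ℝ (fun x y => (A x y).restrictScalars ℝ)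
    (by intros; ext; simp) (by intros; ext; simp [LinearMap.map_smul_of_tower])
    (by intros; ext; simp) (by intros; ext; simp [LinearMap.map_smul_of_tower])

lemma res_apply (A : Tri ℂ V) (x y z : V) : res A x y z = A x y z := by simp [res]

lemma lift_tri (A : V →ₗ[ℝ] V →ₗ[ℝ] V →ₗ[ℝ] V)
    (hx : ∀ x y z, A (Complex.I • x) y z = Complex.I • A x y z)
    (hy : ∀ x y z, A x (Complex.I • y) z = Complex.I • A x y z)
    (hz : ∀ x y z, A x y (Complex.I • z) = Complex.I • A x y z) :
    ∃ A' : Tri ℂ V, res A' = A := by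
  let f : V → V → (V →ₗ[ℂ] V) := fun x y =>
    { toFun := fun z => A x y z
      map_add' := by intros; simp
      map_smul' := by
        intro c z
        simp only [RingHom.id_apply]
        rw [csmul c z, csmul c (A x y z), map_add, map_smul, map_smul, hz] }
  have hf : ∀ x y z, f x y z = A x y z := fun _ _ _ => rfl
  refine ⟨LinearMap.mk₂ ℂ f ?_ ?_ ?_ ?_, ?_⟩
  · intros; ext; simp [hf]
  · intro c x y; ext z
    simp only [hf, LinearMap.smul_apply]
    rw [csmul c x, csmul c (A x y z)]
    simp only [map_add, map_smul, LinearMap.add_apply, LinearMap.smul_apply, hx]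
  · intros; ext; simp [hf]
  · intro c x y; ext z
    simp only [hf, LinearMap.smul_apply]
    rw [csmul c y, csmul c (A x y z)]
    simp only [map_add, map_smul, LinearMap.add_apply, LinearMap.smul_apply, hy]
  · ext x y z
    rw [res_apply]; simp [hf]

lemma trRe [FiniteDimensional ℂ V] (f : V →ₗ[ℂ] V) :
    LinearMap.trace ℝ V (f.restrictScalars ℝ) = 2 * (LinearMap.trace ℂ V f).re := by
  classical
  let b := finBasis ℂ V
  rw [LinearMap.trace_eq_matrix_trace ℝ (Complex.basisOneI.smulTower b),
    LinearMap.trace_eq_matrix_trace ℂ b]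
  simp only [Matrix.trace, Matrix.diag_apply, LinearMap.toMatrix_apply, Fintype.sum_prod_type,
    Basis.smulTower_apply, Basis.smulTower_repr, Fin.sum_univ_two, Complex.re_sum]
  simp [two_mul]

lemma rho_res [FiniteDimensional ℂ V] (A : Tri ℂ V) (x y : V) :
    rho (res A) x y = 2 * (LinearMap.trace ℂ V ((A.flip x).flip y)).re := by
  rw [← trRe, rho]
  congr 1

variable [FiniteDimensional ℂ V] (J : V →ₗ[ℝ] V) (hJ : ∀ v, J v = Complex.I • v)
include hJ

lemma toW (A : V →ₗ[ℝ] V →ₗ[ℝ] V →ₗ[ℝ] V) (hA : IsKminus J A) (hr : ∀ x y, rho A x y = 0) :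
    ∃ A' ∈ Wsub ℂ V, res A' = A := by
  obtain ⟨⟨⟨hs, hB⟩, hc⟩, hm⟩ := hA
  have hJJ : ∀ v, J (J v) = -v := by
    intro v; rw [hJ, hJ, smul_smul, Complex.I_mul_I, neg_one_smul]
  have h1 : ∀ x y, A (J x) y = A x (J y) := by
    intro x y
    have := hm x (J y)
    rw [hJJ, map_neg] at this
    exact neg_injective this
  have h2 : ∀ x y z, A (J x) y z = - A (J y) x z := by
    intro x y z; rw [h1 x y, hs x (J y)]; rfl
  have hs' : ∀ x y z, A x y z = - A y x z := by
    intro x y z; rw [hs x y]; rfl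
  let D : V → V → V → V := fun x y z => A (J x) y z - J (A x y z)
  have hD : ∀ x y z, D z x y = - D x y z := by
    intro x y z
    have e1 := hB (J x) y z
    have e2 := congrArg J (hB x y z)
    rw [hc, ← h1] at e1
    simp only [map_add, map_zero] at e2
    simp only [D]
    linear_combination (norm := module) e1 - e2
  have hD0 : ∀ x y z, D x y z = 0 := by
    intro x y z
    have e : D x y z = - D x y z := by
      conv_lhs => rw [hD y z x, hD z x y, hD x y z, neg_neg]
    have : (2 : ℝ) • D x y z = 0 := by rw [two_smul]; nth_rewrite 1 [e]; simp
    simpa using this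
  have hx : ∀ x y z, A (J x) y z = J (A x y z) := fun x y z => sub_eq_zero.1 (hD0 x y z)
  have hy : ∀ x y z, A x (J y) z = J (A x y z) := by
    intro x y z; rw [← h1, hx]
  obtain ⟨A', rfl⟩ := lift_tri A (by simpa only [← hJ] using hx) (by simpa only [← hJ] using hy)
    (by simpa only [← hJ] using hc)
  refine ⟨A', ⟨?_, ?_, ?_⟩, rfl⟩
  · simpa only [res_apply] using hs'
  · simpa only [res_apply] using hB
  · intro x y
    have r1 := hr x y
    have r2 := hr x (Complex.I • y)
    rw [rho_res] at r1 r2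
    have e : (A'.flip x).flip (Complex.I • y) = Complex.I • (A'.flip x).flip y := by
      ext; simp
    rw [e, map_smul] at r2
    simp at r1 r2
    exact Complex.ext r1 r2

lemma ofW (A : Tri ℂ V) (hA : A ∈ Wsub ℂ V) :
    IsKminus J (res A) ∧ ∀ x y, rho (res A) x y = 0 := by
  obtain ⟨hs, hB, hR⟩ := hA
  refine ⟨⟨⟨⟨?_, ?_⟩, ?_⟩, ?_⟩, ?_⟩
  · intro x y; ext z; simp only [LinearMap.neg_apply, res_apply]; exact hs x y z
  · intro x y z; simp only [res_apply]; exact hB x y z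
  · intro x y z; simp only [res_apply, hJ, map_smul]
  · intro x y; ext z
    simp only [LinearMap.neg_apply, res_apply, hJ, map_smul, LinearMap.smul_apply, smul_smul,
      Complex.I_mul_I, neg_one_smul]
  · intro x y; rw [rho_res, hR]; simp

lemma mainJ (hm : 6 ≤ finrank ℝ V) :
    (∃ A : V →ₗ[ℝ] V →ₗ[ℝ] V →ₗ[ℝ] V,
      IsKminus J A ∧ (∀ x y, rho A x y = 0) ∧ A ≠ 0) ∧
    (∀ ξ : Submodule ℝ (V →ₗ[ℝ] V →ₗ[ℝ] V →ₗ[ℝ] V),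
      (∀ A ∈ ξ, IsKminus J A ∧ ∀ x y, rho A x y = 0) →
      (∀ g : V ≃ₗ[ℝ] V, IsGLstar J g → ∀ A ∈ ξ, ∀ B : V →ₗ[ℝ] V →ₗ[ℝ] V →ₗ[ℝ] V,
        (∀ x y z, B x y z = g (A (g.symm x) (g.symm y) (g.symm z))) → B ∈ ξ) →
      ξ = ⊥ ∨ ∀ A : V →ₗ[ℝ] V →ₗ[ℝ] V →ₗ[ℝ] V,
        IsKminus J A → (∀ x y, rho A x y = 0) → A ∈ ξ) := by
  have hn : 3 ≤ finrank ℂ V := by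
    have := Module.finrank_mul_finrank ℝ ℂ V
    rw [Complex.finrank_real_complex] at this
    omega
  have res0 : ∀ A : Tri ℂ V, res A = 0 → A = 0 := by
    intro A h
    ext x y z
    rw [← res_apply, h]; rfl
  refine ⟨?_, ?_⟩
  · obtain ⟨A, hA, h0⟩ := existsK (K := ℂ) hn
    exact ⟨res A, (ofW J hJ A hA).1, (ofW J hJ A hA).2, fun h => h0 (res0 A h)⟩
  intro ξ hW hg
  have hinv : ∀ g : V ≃ₗ[ℂ] V, ∀ A : Tri ℂ V, res A ∈ ξ → res (act g A) ∈ ξ := by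
    intro g A hA
    refine hg (g.restrictScalars ℝ) (Or.inl fun v => ?_) (res A) hA _ fun x y z => ?_
    · simp [hJ]
    · simp only [res_apply, act_apply]; rfl
  let ξ' : Submodule ℂ (Tri ℂ V) :=
    { carrier := {A | res A ∈ ξ}
      zero_mem' := by
        have : res (0 : Tri ℂ V) = 0 := by ext; simp [res_apply]
        simp only [Set.mem_ofPred_eq, this]; exact ξ.zero_mem
      add_mem' := by
        intro A B hA hB
        have : res (A + B) = res A + res B := by ext; simp [res_apply]
        simp only [Set.mem_ofPred_eq] at *
        rw [this]; exact ξ.add_mem hA hB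
      smul_mem' := by
        intro c A hA
        simp only [Set.mem_ofPred_eq] at *
        by_cases hc : c = 0
        · have : res (c • A) = 0 := by ext; simp [res_apply, hc]
          rw [this]; exact ξ.zero_mem
        obtain ⟨μ, hμ⟩ := IsAlgClosed.exists_pow_nat_eq c⁻¹ (n := 2) (by norm_num)
        have hμ0 : μ ≠ 0 := by
          rintro rfl
          exact hc (by simpa using hμ.symm)
        have : c • A = act (LinearEquiv.smulOfNeZero ℂ V μ hμ0) A := by
          have hsy : ∀ x, (LinearEquiv.smulOfNeZero ℂ V μ hμ0).symm x = μ⁻¹ • x := by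
            intro x
            rw [LinearEquiv.symm_apply_eq, LinearEquiv.smulOfNeZero_apply, smul_inv_smul₀ hμ0]
          ext x y z
          rw [act_apply, hsy, hsy, hsy]
          simp only [LinearEquiv.smulOfNeZero_apply, map_smul, LinearMap.smul_apply, smul_smul]
          congr 1
          have : c = (μ ^ 2)⁻¹ := by rw [hμ, inv_inv]
          rw [this]; field_simp
        rw [this]; exact hinv _ A hA }
  have hmem : ∀ A, A ∈ ξ' ↔ res A ∈ ξ := fun A => Iff.rfl
  by_cases hb : ξ = ⊥
  · exact Or.inl hb
  refine Or.inr fun A hA hr => ?_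
  have hle : ξ' ≤ Wsub ℂ V := by
    intro A hA
    obtain ⟨A', hA', he⟩ := toW J hJ (res A) (hW _ hA).1 (hW _ hA).2
    have : A' = A := by
      ext x y z
      rw [← res_apply, he, res_apply]
    exact this ▸ hA'
  have hne : ξ' ≠ ⊥ := by
    intro h
    apply hb
    rw [Submodule.eq_bot_iff]
    intro A hA
    obtain ⟨A', hA', rfl⟩ := toW J hJ A (hW _ hA).1 (hW _ hA).2
    have h1 : A' ∈ ξ' := hA
    rw [h, Submodule.mem_bot] at h1
    ext x y z
    simp [res_apply, h1]
  have heq := mainK hn ξ' hle (fun g A hA => hinv g A hA) hne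
  obtain ⟨A', hA', rfl⟩ := toW J hJ A hA hr
  rw [← heq] at hA'
  exact hA'
end trf
end KW

/-- if `m ≥ 6`, then `K₋ ∩ ker ρ` is a nonzero irreducible `GL_ℂ*` module. -/
theorem statement2 [FiniteDimensional ℝ V] (J : V →ₗ[ℝ] V) (hJ : ∀ v, J (J v) = -v)
    (hm : 6 ≤ finrank ℝ V) :
    (∃ A : V →ₗ[ℝ] V →ₗ[ℝ] V →ₗ[ℝ] V,
      IsKminus J A ∧ (∀ x y, rho A x y = 0) ∧ A ≠ 0) ∧
    (∀ ξ : Submodule ℝ (V →ₗ[ℝ] V →ₗ[ℝ] V →ₗ[ℝ] V),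
      (∀ A ∈ ξ, IsKminus J A ∧ ∀ x y, rho A x y = 0) →
      (∀ g : V ≃ₗ[ℝ] V, IsGLstar J g → ∀ A ∈ ξ, ∀ B : V →ₗ[ℝ] V →ₗ[ℝ] V →ₗ[ℝ] V,
        (∀ x y z, B x y z = g (A (g.symm x) (g.symm y) (g.symm z))) → B ∈ ξ) →
      ξ = ⊥ ∨ ∀ A : V →ₗ[ℝ] V →ₗ[ℝ] V →ₗ[ℝ] V,
        IsKminus J A → (∀ x y, rho A x y = 0) → A ∈ ξ) := by

  have hJ2 : J * J = (-1 : Module.End ℝ V) := by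
    ext v; simp [hJ]
  let φ : ℂ →ₐ[ℝ] Module.End ℝ V := Complex.lift ⟨J, hJ2⟩
  letI : Module ℂ V := Module.compHom V φ.toRingHom
  have hsm : ∀ (c : ℂ) (v : V), c • v = φ c v := fun _ _ => rfl
  haveI : IsScalarTower ℝ ℂ V := ⟨fun r c v => by
    rw [hsm, hsm, map_smul]; rfl⟩
  haveI : FiniteDimensional ℂ V := Module.Finite.of_restrictScalars_finite ℝ ℂ V
  refine KW.mainJ J (fun v => ?_) hm
  rw [hsm]
  simp [φ]
end

section
/- If m = 4, then K₋ ∩ ker(ρ) = {0}: every A ∈ K₋ with ρ(A) = 0 is identically zero. -/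
open Module

variable {V : Type*} [AddCommGroup V] [Module ℝ V]

theorem aux_basis [FiniteDimensional ℝ V] (J : V →ₗ[ℝ] V) (hJ : ∀ v, J (J v) = -v)
    (hm : finrank ℝ V = 4) :
    ∃ (b : Basis (Fin 4) ℝ V), b 1 = J (b 0) ∧ b 3 = J (b 2) := by
  have key : ∀ (W : Submodule ℝ V), (∀ w ∈ W, J w ∈ W) → ∀ f, f ∉ W → ∀ c d : ℝ,
      c • f + d • J f ∈ W → c = 0 ∧ d = 0 := by
    intro W hW f hf c d h
    have h2 : c • (c • f + d • J f) - d • J (c • f + d • J f) ∈ W :=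
      W.sub_mem (W.smul_mem _ h) (W.smul_mem _ (hW _ h))
    have h3 : c • (c • f + d • J f) - d • J (c • f + d • J f) = (c ^ 2 + d ^ 2) • f := by
      simp only [map_add, map_smul, hJ]
      module
    rw [h3] at h2
    by_cases h0 : c ^ 2 + d ^ 2 = 0
    · constructor <;> nlinarith [sq_nonneg c, sq_nonneg d]
    · exact absurd ((W.smul_mem_iff h0).1 h2) hf
  have : Nontrivial V := Module.nontrivial_of_finrank_pos (R := ℝ) (by omega)
  obtain ⟨e, he⟩ := exists_ne (0 : V)
  obtain ⟨f, hf⟩ : ∃ f, f ∉ Submodule.span ℝ {e, J e} := by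
    by_contra! h
    have h1 : Submodule.span ℝ {e, J e} = ⊤ := by
      rw [eq_top_iff]; intro x _; exact h x
    classical
    have h2 := finrank_span_finset_le_card (R := ℝ) ({e, J e} : Finset V)
    have h3 : ({e, J e} : Finset V).card ≤ 2 := Finset.card_le_two
    rw [Set.finrank, Finset.coe_pair, h1, finrank_top, hm] at h2
    omega
  have hli : LinearIndependent ℝ ![e, J e, f, J f] := by
    rw [Fintype.linearIndependent_iff]
    intro g hg
    simp [Fin.sum_univ_four] at hg
    obtain ⟨h2, h3⟩ := key (Submodule.span ℝ {e, J e}) (by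
      intro w hw
      obtain ⟨a, b, rfl⟩ := Submodule.mem_span_pair.1 hw
      refine Submodule.mem_span_pair.2 ⟨-b, a, ?_⟩
      simp only [map_add, map_smul, hJ]
      module) f hf (g 2) (g 3) (Submodule.mem_span_pair.2 ⟨-g 0, -g 1, by
        rw [← sub_eq_zero, ← neg_eq_zero, ← hg]; module⟩)
    obtain ⟨h0, h1⟩ := key ⊥ (by simp) e (by simpa using he) (g 0) (g 1) (by
      simpa [h2, h3] using hg)
    intro i
    fin_cases i <;> assumption
  refine ⟨basisOfLinearIndependentOfCardEqFinrank hli (by simp [hm]), ?_, ?_⟩ <;> simp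

theorem aux_J (J : V →ₗ[ℝ] V) (hJ : ∀ v, J (J v) = -v)
    (A : V →ₗ[ℝ] V →ₗ[ℝ] V →ₗ[ℝ] V) (h : IsKminus J A) (x y z : V) :
    A (J x) y z = J (A x y z) := by
  obtain ⟨⟨⟨hs, hb⟩, hk⟩, hm⟩ := h
  have hsw : ∀ x y, A (J x) y = A x (J y) := by
    intro x y
    have := hm x (J y)
    rw [hJ, map_neg] at this
    exact neg_injective this
  have hD : ∀ x y z, A (J x) y z - J (A x y z) = - (A (J z) x y - J (A z x y)) := by
    intro x y z
    have h1 := hb (J x) y z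
    have h2 := congrArg J (hb x y z)
    rw [hk, ← hsw] at h1
    simp only [map_add, map_zero] at h2
    rw [← sub_eq_zero, ← sub_eq_zero.2 (h1.trans h2.symm)]
    abel
  have h3 := hD x y z
  rw [hD z x y, hD y z x] at h3
  rw [neg_neg] at h3
  have h4 : (2 : ℝ) • (A (J x) y z - J (A x y z)) = 0 := by
    rw [two_smul]; nth_rewrite 1 [h3]; simp
  simpa [sub_eq_zero] using h4

/-- if `m = 4`, then `K₋ ∩ ker ρ = {0}`. -/
theorem statement3 [FiniteDimensional ℝ V] (J : V →ₗ[ℝ] V) (hJ : ∀ v, J (J v) = -v)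
    (hm : finrank ℝ V = 4) :
    ∀ A : V →ₗ[ℝ] V →ₗ[ℝ] V →ₗ[ℝ] V,
      IsKminus J A → (∀ x y, rho A x y = 0) → A = 0 := by
  intro A hA hr
  obtain ⟨b, hb1, hb3⟩ := aux_basis J hJ hm
  have hAJ := aux_J J hJ A hA
  obtain ⟨⟨⟨hs, -⟩, hk⟩, -⟩ := hA
  have hself : ∀ x z, A x x z = 0 := by
    intro x z
    have h := congrArg (fun L => L z) (hs x x)
    simp only [LinearMap.neg_apply] at h
    have h4 : (2 : ℝ) • A x x z = 0 := by
      rw [two_smul]; nth_rewrite 1 [h]; simp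
    simpa using h4
  have hAJ2 : ∀ x y z, A x (J y) z = J (A x y z) := by
    intro x y z
    rw [hs x, hs x, LinearMap.neg_apply, LinearMap.neg_apply, hAJ, map_neg]
  have hrep : ∀ w, J w = (-(b.repr w 1)) • b 0 + (b.repr w 0) • b 1
      + (-(b.repr w 3)) • b 2 + (b.repr w 2) • b 3 := by
    intro w
    conv_lhs => rw [← b.sum_repr w]
    simp only [Fin.sum_univ_four, map_add, map_smul, hb1, hb3, hJ]
    module
  have c0 : ∀ w, b.repr (J w) 0 = - b.repr w 1 := by
    intro w; rw [hrep w]; simp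
  have c1 : ∀ w, b.repr (J w) 1 = b.repr w 0 := by
    intro w; rw [hrep w]; simp
  have c2 : ∀ w, b.repr (J w) 2 = - b.repr w 3 := by
    intro w; rw [hrep w]; simp
  have c3 : ∀ w, b.repr (J w) 3 = b.repr w 2 := by
    intro w; rw [hrep w]; simp
  have htr : ∀ x y, b.repr (A (b 0) x y) 0 + b.repr (A (b 1) x y) 1
      + b.repr (A (b 2) x y) 2 + b.repr (A (b 3) x y) 3 = 0 := by
    intro x y
    have h := hr x y
    rw [rho, LinearMap.trace_eq_matrix_trace ℝ b, Matrix.trace, Fin.sum_univ_four] at h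
    simpa [LinearMap.toMatrix_apply] using h
  have t0 : ∀ y, b.repr (A (b 0) (b 2) y) 0 = 0 := by
    intro y
    have h := htr (b 2) y
    rw [hb1, hb3, hAJ, hAJ, hself, c1] at h
    simp at h
    linarith
  have t2 : ∀ y, b.repr (A (b 0) (b 2) y) 2 = 0 := by
    intro y
    have h := htr (b 0) y
    rw [hb1, hb3, hAJ, hAJ, hself, c3, hs (b 2)] at h
    simp at h
    linarith
  have t1 : ∀ y, b.repr (A (b 0) (b 2) y) 1 = 0 := by
    intro y
    have h := t0 (J y)
    rw [hk, c0] at h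
    linarith
  have t3 : ∀ y, b.repr (A (b 0) (b 2) y) 3 = 0 := by
    intro y
    have h := t2 (J y)
    rw [hk, c2] at h
    linarith
  have hT : ∀ y, A (b 0) (b 2) y = 0 := by
    intro y
    apply b.repr.injective
    ext i
    fin_cases i
    · simpa using t0 y
    · simpa using t1 y
    · simpa using t2 y
    · simpa using t3 y
  have hT' : ∀ y, A (b 2) (b 0) y = 0 := by
    intro y; rw [hs, LinearMap.neg_apply, hT, neg_zero]
  refine b.ext fun i => b.ext fun j => LinearMap.ext fun z => ?_
  fin_cases i <;> fin_cases j <;> simp [hb1, hb3, hAJ, hAJ2, hself, hT, hT']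
end

section
/- For every ψ ∈ Λ²₊, the operator σ₃ψ belongs to K₊ (i.e., σ₃ψ is an affine curvature operator, commutes with J, and satisfies (σ₃ψ)(Jx,Jy) = (σ₃ψ)(x,y)), and ρ(σ₃ψ) = -(m+2)ψ. -/
open Module

variable {V : Type*} [AddCommGroup V] [Module ℝ V]

/-- `A ∈ K₊`. -/
def IsKplus (J : V →ₗ[ℝ] V) (A : V →ₗ[ℝ] V →ₗ[ℝ] V →ₗ[ℝ] V) : Prop :=
  IsK J A ∧ ∀ x y, A (J x) (J y) = A x y

theorem trace_J_zero [FiniteDimensional ℝ V] (J : V →ₗ[ℝ] V) (hJ : ∀ v, J (J v) = -v) :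
    LinearMap.trace ℝ V J = 0 := by
  have hJ2 : (J : Module.End ℝ V) * J = -1 := by
    ext v; simp [hJ]
  let F : ℂ →ₐ[ℝ] Module.End ℝ V := Complex.lift ⟨J, hJ2⟩
  letI : Module ℂ V := Module.compHom V F.toRingHom
  have hsm : ∀ (c : ℂ) (v : V), c • v = F c v := fun c v => rfl
  haveI : IsScalarTower ℝ ℂ V := ⟨fun a c v => by
    rw [hsm, hsm, map_smul]; rfl⟩
  have hI : ∀ v : V, Complex.I • v = J v := fun v => by
    rw [hsm]; simp [F]
  haveI : FiniteDimensional ℂ V := FiniteDimensional.right ℝ ℂ V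
  let b := Module.finBasis ℂ V
  rw [LinearMap.trace_eq_matrix_trace ℝ (Complex.basisOneI.smulTower b), Matrix.trace]
  apply Finset.sum_eq_zero
  rintro ⟨i, j⟩ -
  rw [Matrix.diag_apply, LinearMap.toMatrix_apply, ← hI, Module.Basis.smulTower_repr,
    Module.Basis.smulTower_apply]
  fin_cases i <;> simp

/-- for `ψ ∈ Λ²₊`, `σ₃ψ ∈ K₊` and `ρ(σ₃ψ) = -(m+2)ψ`. -/
theorem statement8 [FiniteDimensional ℝ V] (J : V →ₗ[ℝ] V) (hJ : ∀ v, J (J v) = -v)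
    (φ : V →ₗ[ℝ] V →ₗ[ℝ] ℝ) (hsym : ∀ x y, φ x y = - φ y x) (hJφ : ∀ x y, φ (J x) (J y) = φ x y)
    (S : V →ₗ[ℝ] V →ₗ[ℝ] V →ₗ[ℝ] V)
    (hS : ∀ x y z, S x y z = φ x z • y - φ y z • x + (2 * φ x y) • z - φ x (J z) • J y + φ y (J z) • J x) :
    IsKplus J S ∧ ∀ x y, rho S x y = (-((finrank ℝ V : ℝ) + 2)) * φ x y := by
  refine ⟨⟨⟨⟨?_, ?_⟩, ?_⟩, ?_⟩, ?_⟩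
  · intro x y
    ext z
    rw [LinearMap.neg_apply, hS, hS, hsym y x]
    module
  · intro x y z
    have h : ∀ u v, φ u (J v) = φ v (J u) := fun u v => by
      rw [← hJφ u (J v), hJ, map_neg, hsym v]; 
    rw [hS, hS, hS, hsym y x, hsym z x, hsym z y, h y x, h z x, h z y]
    module
  · intro x y z
    simp only [hS, map_add, map_sub, map_smul, hJ, map_neg]
    module
  · intro x y
    have h : ∀ u v, φ (J u) v = - φ u (J v) := fun u v => by
      rw [← hJφ u (J v), hJ, map_neg, neg_neg]
    ext z
    simp only [hS, hJ, hJφ, h]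
    module
  · intro x y
    have key : (S.flip x).flip y = (φ.flip y).smulRight x - φ x y • LinearMap.id
        + (2:ℝ) • (φ.flip x).smulRight y - (φ.flip (J y)).smulRight (J x) + φ x (J y) • J := by
      ext z
      simp [hS, mul_smul]
    rw [rho, key]
    simp only [map_add, map_sub, map_smul, LinearMap.trace_smulRight, trace_J_zero J hJ,
      LinearMap.trace_id, LinearMap.flip_apply, hJφ, smul_eq_mul]
    rw [hsym y x]
    ring
end

section
/- For every ψ ∈ Λ²₀₊, the operator σ₃ψ satisfies ρ₁₃(σ₃ψ) = -2ψ. -/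
open Module
open scoped RealInnerProductSpace

variable {V : Type*} [NormedAddCommGroup V] [InnerProductSpace ℝ V] [FiniteDimensional ℝ V]

/-- for `ψ ∈ Λ²₀₊`, `ρ₁₃(σ₃ψ) = -2ψ`. -/
theorem statement12 {m : ℕ} (e : OrthonormalBasis (Fin m) ℝ V)
    (J : V →ₗ[ℝ] V) (hJ : ∀ v, J (J v) = -v)
    (hJinner : ∀ x y : V, ⟪J x, J y⟫ = ⟪x, y⟫)
    (φ : V →ₗ[ℝ] V →ₗ[ℝ] ℝ) (hsym : ∀ x y, φ x y = - φ y x)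
    (hJφ : ∀ x y, φ (J x) (J y) = φ x y) (htr : ∑ i, φ (e i) (J (e i)) = 0)
    (S : V →ₗ[ℝ] V →ₗ[ℝ] V →ₗ[ℝ] V)
    (hS : ∀ x y z, S x y z = φ x z • y - φ y z • x + (2 * φ x y) • z - φ x (J z) • J y + φ y (J z) • J x) :
    ∀ x y, (∑ i, ⟪S (e i) x (e i), y⟫) = (-2) * φ x y := by
  intro x y
  have key : ∀ (f : V →ₗ[ℝ] ℝ) (v : V), ∑ i, f (e i) * ⟪e i, v⟫ = f v := by
    intro f v
    conv_rhs => rw [← e.sum_repr' v]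
    rw [map_sum]
    refine Finset.sum_congr rfl fun i _ => ?_
    rw [map_smul, smul_eq_mul, mul_comm]
  have hJy : ∀ v, ⟪J v, y⟫ = - ⟪v, J y⟫ := by
    intro v
    have h := hJinner (J v) y
    rw [hJ, inner_neg_left] at h
    exact h.symm
  have h0 : ∀ v, φ v v = 0 := fun v => by linarith [hsym v v]
  have h1 := key (φ x) y
  have h2 := key (φ x ∘ₗ J) (J y)
  simp only [LinearMap.comp_apply, hJ, map_neg] at h2
  have hterm : ∀ i, ⟪S (e i) x (e i), y⟫ = (-3) * (φ x (e i) * ⟪e i, y⟫)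
      - φ (e i) (J (e i)) * ⟪J x, y⟫ - φ x (J (e i)) * ⟪e i, J y⟫ := by
    intro i
    rw [hS, h0, hsym (e i) x]
    simp only [inner_add_left, inner_sub_left, real_inner_smul_left, hJy (e i)]
    ring
  simp only [hterm, Finset.sum_sub_distrib, ← Finset.mul_sum, ← Finset.sum_mul, htr, h1, h2]
  ring
end
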